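/- arXiv:math/0702047 — 3 statements merged into one kernel-verified Lean document; each statement's English description precedes it below -/
import Mathlib

section
/- Let n ≥ 2, α ∈ ℝ with n + α − 2 > 0, let Bⁿ = {x ∈ ℝⁿ : |x| < 1}, p(x) = 2/(1−|x|²), and d(x) = log((1+|x|)/(1−|x|)). Then there exists a constant c > 0 such that for every compactly supported smooth function φ on Bⁿ \ {0}: ∫_{Bⁿ} d^α |∇φ|² p^{n−2} dx ≥ ((n+α−2)/2)² · ∫_{Bⁿ} d^{α−2} φ² p^n dx + c·2^{n−2} · ∫_{Bⁿ} d^α φ² dx. -/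
open MeasureTheory Metric

/-- The conformal factor of the Poincaré ball model of hyperbolic space. -/
noncomputable def pc {n : ℕ} (x : EuclideanSpace ℝ (Fin n)) : ℝ := 2 / (1 - ‖x‖ ^ 2)

/-- The hyperbolic distance to the origin in the Poincaré ball model. -/
noncomputable def dH {n : ℕ} (x : EuclideanSpace ℝ (Fin n)) : ℝ :=
  Real.log ((1 + ‖x‖) / (1 - ‖x‖))

/-- The Euler identity `∫ ⟨∇Ψ, x⟩ = -n ∫ Ψ` for compactly supported `C¹` functions on `ℝⁿ`. -/
theorem integral_fderiv_apply_self_of_hasCompactSupport {n : ℕ}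
    {Ψ : EuclideanSpace ℝ (Fin n) → ℝ} (hΨ : ContDiff ℝ 1 Ψ) (hc : HasCompactSupport Ψ) :
    ∫ x, fderiv ℝ Ψ x x = -(n * ∫ x, Ψ x) := by
  have hcont : Continuous (fderiv ℝ Ψ) := hΨ.continuous_fderiv one_ne_zero
  have hint (i : Fin n) : Integrable fun x : EuclideanSpace ℝ (Fin n) =>
      x i * fderiv ℝ Ψ x (EuclideanSpace.single i 1) :=
    Continuous.integrable_of_hasCompactSupport
      (Continuous.mul (by fun_prop) (hcont.clm_apply continuous_const))
      (hc.fderiv_apply ℝ _).mul_left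
  have hcoord (i : Fin n) (x : EuclideanSpace ℝ (Fin n)) :
      HasFDerivAt (fun x : EuclideanSpace ℝ (Fin n) => x i)
        (EuclideanSpace.proj (𝕜 := ℝ) i) x :=
    (EuclideanSpace.proj (𝕜 := ℝ) (ι := Fin n) i).hasFDerivAt
  have hparts (i : Fin n) :
      ∫ x : EuclideanSpace ℝ (Fin n), x i * fderiv ℝ Ψ x (EuclideanSpace.single i 1) =
        -∫ x, Ψ x := by
    rw [integral_mul_fderiv_eq_neg_fderiv_mul_of_integrable _ (hint i)
      (Continuous.integrable_of_hasCompactSupport (by fun_prop) hc.mul_left)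
      (fun x _ => (hcoord i x).differentiableAt)
      (fun x _ => hΨ.differentiable one_ne_zero x)]
    · simp [(hcoord i _).fderiv]
    · simpa [(hcoord i _).fderiv] using hΨ.continuous.integrable_of_hasCompactSupport hc
  have hsum (x : EuclideanSpace ℝ (Fin n)) :
      fderiv ℝ Ψ x x = ∑ i, x i * fderiv ℝ Ψ x (EuclideanSpace.single i 1) := by
    simpa using congrArg (fderiv ℝ Ψ x) ((EuclideanSpace.basisFun (Fin n) ℝ).sum_repr x).symm
  simp_rw [hsum]
  rw [integral_finsetSum _ fun i _ => hint i]
  simp [hparts]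

/-- The radial profile of the vector field `x ↦ d^(α-1) p^(n-1) x / |x|` in dimension `m + 2`. -/
noncomputable def radialHardyWeight (m : ℕ) (α r : ℝ) : ℝ :=
  Real.log ((1 + r) / (1 - r)) ^ (α - 1) * (2 / (1 - r ^ 2)) ^ (m + 1) / r

theorem two_mul_le_log_one_add_div_one_sub {r : ℝ} (h0 : 0 ≤ r) (h1 : r < 1) :
    2 * r ≤ Real.log ((1 + r) / (1 - r)) := by
  have h := Real.sum_range_le_log_div h0 h1 1
  simp at h
  linarith

theorem log_one_add_div_one_sub_le {r : ℝ} (h0 : 0 ≤ r) (h1 : r < 1) :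
    Real.log ((1 + r) / (1 - r)) ≤ 2 * (2 / (1 - r ^ 2) * r) := by
  have hr : 0 < 1 - r := by linarith
  calc Real.log ((1 + r) / (1 - r)) ≤ (1 + r) / (1 - r) - 1 :=
        Real.log_le_sub_one_of_pos (by positivity)
    _ = 2 * r * (1 + r) / (1 - r ^ 2) := by
        have : 1 - r ^ 2 = (1 - r) * (1 + r) := by ring
        rw [this]
        field_simp
        ring
    _ ≤ 2 * r * 2 / (1 - r ^ 2) := by
        have : 0 < 1 - r ^ 2 := by nlinarith
        gcongr
        linarith
    _ = 2 * (2 / (1 - r ^ 2) * r) := by ring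

theorem hasDerivAt_log_one_add_div_one_sub {r : ℝ} (h0 : 0 ≤ r) (h1 : r < 1) :
    HasDerivAt (fun r : ℝ => Real.log ((1 + r) / (1 - r))) (2 / (1 - r ^ 2)) r := by
  have hr : 1 - r ≠ 0 := by linarith
  have hr' : 1 + r ≠ 0 := by linarith
  have h := (((hasDerivAt_id r).const_add 1).div ((hasDerivAt_id r).const_sub 1) hr).log
    (div_ne_zero hr' hr)
  refine h.congr_deriv ?_
  have : 1 - r ^ 2 = (1 - r) * (1 + r) := by ring
  rw [this]
  simp only [id, Pi.div_apply]
  field_simp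
  ring

theorem hasDerivAt_radialHardyWeight (m : ℕ) (α : ℝ) {r : ℝ} (h0 : 0 < r) (h1 : r < 1) :
    HasDerivAt (radialHardyWeight m α)
      (Real.log ((1 + r) / (1 - r)) ^ (α - 2) * (2 / (1 - r ^ 2)) ^ (m + 1) / r *
        ((α - 1) * (2 / (1 - r ^ 2)) + Real.log ((1 + r) / (1 - r)) *
          ((m + 1) * (2 / (1 - r ^ 2)) * r - 1 / r))) r := by
  have hd : 0 < Real.log ((1 + r) / (1 - r)) := by
    linarith [two_mul_le_log_one_add_div_one_sub h0.le h1]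
  have hq : 0 < 1 - r ^ 2 := by nlinarith
  have hp : HasDerivAt (fun r : ℝ => 2 / (1 - r ^ 2)) ((2 / (1 - r ^ 2)) ^ 2 * r) r := by
    refine ((hasDerivAt_const r (2 : ℝ)).div ((hasDerivAt_pow 2 r).const_sub 1)
      hq.ne').congr_deriv ?_
    field_simp
    ring
  have h := (((hasDerivAt_log_one_add_div_one_sub h0.le h1).rpow_const (p := α - 1)
    (Or.inl hd.ne')).mul (hp.pow (m + 1))).div (hasDerivAt_id r) h0.ne'
  refine h.congr_deriv ?_
  have e1 : Real.log ((1 + r) / (1 - r)) ^ (α - 1) =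
      Real.log ((1 + r) / (1 - r)) ^ (α - 2) * Real.log ((1 + r) / (1 - r)) := by
    rw [← Real.rpow_add_one hd.ne']
    ring_nf
  have e2 : α - 1 - 1 = α - 2 := by ring
  simp only [Pi.mul_apply, Pi.pow_apply, id, e1, e2, Nat.add_sub_cancel]
  generalize Real.log ((1 + r) / (1 - r)) ^ (α - 2) = W
  generalize Real.log ((1 + r) / (1 - r)) = d
  generalize 2 / (1 - r ^ 2) = p
  push_cast
  field_simp
  ring

theorem contDiffAt_radialHardyWeight (m : ℕ) (α : ℝ) {r : ℝ} (h0 : 0 < r) (h1 : r < 1) :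
    ContDiffAt ℝ 1 (radialHardyWeight m α) r := by
  have hd : 0 < Real.log ((1 + r) / (1 - r)) := by
    linarith [two_mul_le_log_one_add_div_one_sub h0.le h1]
  have hq : 1 - r ^ 2 ≠ 0 := by nlinarith
  have hr : 1 - r ≠ 0 := by linarith
  have hr' : (1 + r) / (1 - r) ≠ 0 := div_ne_zero (by linarith) hr
  have hlog : ContDiffAt ℝ 1 (fun r : ℝ => Real.log ((1 + r) / (1 - r))) r :=
    ContDiffAt.log ((contDiffAt_const.add contDiffAt_id).div
      (contDiffAt_const.sub contDiffAt_id) hr) hr'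
  have hp : ContDiffAt ℝ 1 (fun r : ℝ => 2 / (1 - r ^ 2)) r :=
    contDiffAt_const.div (contDiffAt_const.sub (contDiffAt_id.pow 2)) hq
  exact ((hlog.rpow_const_of_ne hd.ne').mul
    (hp.pow _)).div contDiffAt_id (ne_of_gt h0)

/-- The pointwise inequality behind the improved Hardy inequality: `W = d^(α-2) p^(n-2)`,
`g = |∇φ|`, `y = ⟨∇φ, x⟩`, `v = φ(x)`, and `N = n - 1`. -/
theorem hardy_pointwise {W N α k d p r g y v : ℝ} (hW : 0 ≤ W) (hN : 0 ≤ N) (hk : 0 ≤ k)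
    (hkα : 2 * k = N + α - 1) (h0 : 0 < r) (hp : p * (1 - r ^ 2) = 2)
    (hd : 2 * r ≤ d) (hd' : d ≤ 2 * (p * r)) (hg : 0 ≤ g) (hy : |y| ≤ g * r) :
    k ^ 2 * (W * v ^ 2 * p ^ 2) + k * N / 4 * (W * d ^ 2 * v ^ 2) ≤
      W * d ^ 2 * g ^ 2 + k * (2 * v * y * (W * d * p / r) + v ^ 2 *
        (W * p * ((α - 1) * p + d * (N * p * r - 1 / r))) +
          (N + 1) * (v ^ 2 * (W * d * p / r))) := by
  have hd0 : 0 < d := by linarith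
  have hy2 : (y / r) ^ 2 ≤ g ^ 2 := by
    rw [sq_le_sq, abs_div, abs_of_pos h0, abs_of_nonneg hg, div_le_iff₀ h0]
    exact hy
  have hsq : 0 ≤ d ^ 2 * g ^ 2 + 2 * k * v * d * p * (y / r) + k ^ 2 * p ^ 2 * v ^ 2 := by
    nlinarith [sq_nonneg (d * (y / r) + k * p * v), mul_le_mul_of_nonneg_left hy2 (sq_nonneg d)]
  have hcoth : p * r + 1 / r = p * (1 + r ^ 2) / (2 * r) := by
    field_simp
    nlinarith
  have hgain : d ^ 2 / 4 ≤ p ^ 2 * (d * (1 + r ^ 2) / (2 * r) - 1) := by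
    have h1 : r ^ 2 ≤ d * (1 + r ^ 2) / (2 * r) - 1 := by
      rw [le_sub_iff_add_le, le_div_iff₀ (by positivity)]
      nlinarith [mul_le_mul_of_nonneg_right hd (by positivity : 0 ≤ 1 + r ^ 2)]
    have h2 : d ^ 2 ≤ (2 * (p * r)) ^ 2 := by gcongr
    nlinarith [mul_le_mul_of_nonneg_left h1 (sq_nonneg p)]
  have hdiv : (α - 1) * p + d * (N * p * r - 1 / r) + (N + 1) * (d / r) =
      2 * k * p + N * p * (d * (1 + r ^ 2) / (2 * r) - 1) := by
    have : α - 1 = 2 * k - N := by linarith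
    rw [this]
    linear_combination N * d * hcoth
  have hrest := mul_le_mul_of_nonneg_left hgain (by positivity : 0 ≤ k * N * v ^ 2)
  have key := mul_nonneg hW (add_nonneg hsq (sub_nonneg.2 hrest))
  linear_combination key - k * v ^ 2 * W * p * hdiv

theorem sharp_improved_hardy_hyperbolic (n : ℕ) (hn : 2 ≤ n) (α : ℝ)
    (hα : 0 < (n : ℝ) + α - 2) :
    ∃ c > (0 : ℝ), ∀ φ : EuclideanSpace ℝ (Fin n) → ℝ, ContDiff ℝ (⊤ : ℕ∞) φ →
      HasCompactSupport φ →
      tsupport φ ⊆ ball (0 : EuclideanSpace ℝ (Fin n)) 1 \ {0} →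
      (∫ x in ball (0 : EuclideanSpace ℝ (Fin n)) 1,
          dH x ^ α * ‖gradient φ x‖ ^ 2 * pc x ^ (n - 2)) ≥
        (((n : ℝ) + α - 2) / 2) ^ 2 *
            (∫ x in ball (0 : EuclideanSpace ℝ (Fin n)) 1,
              dH x ^ (α - 2) * φ x ^ 2 * pc x ^ n) +
          c * 2 ^ (n - 2) *
            (∫ x in ball (0 : EuclideanSpace ℝ (Fin n)) 1, dH x ^ α * φ x ^ 2) := by
  obtain ⟨m, rfl⟩ : ∃ m, n = m + 2 := ⟨n - 2, by omega⟩
  set k : ℝ := (((m + 2 : ℕ) : ℝ) + α - 2) / 2 with hk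
  have hk0 : 0 < k := by positivity
  refine ⟨k * (m + 1) / 4, by positivity, fun φ hφ hc hsupp => ?_⟩
  simp only [Nat.add_sub_cancel, ge_iff_le]
  set U : Set (EuclideanSpace ℝ (Fin (m + 2))) := ball 0 1 \ {0}
  have hUo : IsOpen U := isOpen_ball.sdiff isClosed_singleton
  have hpos {x} (hx : x ∈ U) : 0 < ‖x‖ := norm_pos_iff.2 hx.2
  have hlt {x} (hx : x ∈ U) : ‖x‖ < 1 := mem_ball_zero_iff.1 hx.1
  have hd0 {x} (hx : x ∈ U) : 0 < dH x := by
    have := two_mul_le_log_one_add_div_one_sub (hpos hx).le (hlt hx)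
    unfold dH
    linarith [hpos hx]
  have hq {x} (hx : x ∈ U) : 0 < 1 - ‖x‖ ^ 2 := by nlinarith [hlt hx, hpos hx]
  have hdcont : ContinuousOn (dH (n := m + 2)) U := by
    intro x hx
    exact ((hasDerivAt_log_one_add_div_one_sub (hpos hx).le (hlt hx)).continuousAt.comp
      (f := fun x => ‖x‖) continuous_norm.continuousAt).continuousWithinAt
  have hpcont : ContinuousOn (pc (n := m + 2)) U :=
    continuousOn_const.div (by fun_prop) fun x hx => (hq hx).ne'
  have hrpow (β : ℝ) : ContinuousOn (fun x => dH (n := m + 2) x ^ β) U :=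
    hdcont.rpow_const fun x hx => Or.inl (hd0 hx).ne'
  have hgrad : Continuous (gradient φ) :=
    (InnerProductSpace.toDual ℝ _).symm.continuous.comp (hφ.continuous_fderiv (by simp))
  have hint {F : EuclideanSpace ℝ (Fin (m + 2)) → ℝ} (hF : ContinuousOn F U)
      (hF0 : ∀ x, x ∉ tsupport φ → F x = 0) : Integrable F := by
    have hsub : tsupport F ⊆ tsupport φ :=
      closure_minimal (fun x hx => by_contra fun h => hx (hF0 x h)) (isClosed_tsupport φ)
    exact (hF.continuous_of_tsupport_subset hUo (hsub.trans hsupp)).integrable_of_hasCompactSupport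
      (hc.of_isClosed_subset (isClosed_tsupport F) hsub)
  have hset {F : EuclideanSpace ℝ (Fin (m + 2)) → ℝ}
      (hF0 : ∀ x, x ∉ tsupport φ → F x = 0) : ∫ x in ball 0 1, F x = ∫ x, F x :=
    setIntegral_eq_integral_of_forall_compl_eq_zero fun x hx => hF0 x fun h => hx (hsupp h).1
  have hφ0 (x) (hx : x ∉ tsupport φ) : φ x = 0 := image_eq_zero_of_notMem_tsupport hx
  have hgrad0 (x) (hx : x ∉ tsupport φ) : gradient φ x = 0 := by
    simp [gradient, fderiv_of_notMem_tsupport ℝ hx]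
  have hA0 (x) (hx : x ∉ tsupport φ) : dH x ^ α * ‖gradient φ x‖ ^ 2 * pc x ^ m = 0 := by
    simp [hgrad0 x hx]
  have hB0 (x) (hx : x ∉ tsupport φ) : dH x ^ (α - 2) * φ x ^ 2 * pc x ^ (m + 2) = 0 := by
    simp [hφ0 x hx]
  have hC0 (x) (hx : x ∉ tsupport φ) : dH x ^ α * φ x ^ 2 = 0 := by
    simp [hφ0 x hx]
  have hA : Integrable fun x => dH x ^ α * ‖gradient φ x‖ ^ 2 * pc x ^ m :=
    hint (((hrpow α).mul (hgrad.norm.pow 2).continuousOn).mul (hpcont.pow m)) hA0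
  have hB : Integrable fun x => dH x ^ (α - 2) * φ x ^ 2 * pc x ^ (m + 2) :=
    hint (((hrpow (α - 2)).mul (hφ.continuous.pow 2).continuousOn).mul
      (hpcont.pow (m + 2))) hB0
  have hC : Integrable fun x => dH x ^ α * φ x ^ 2 :=
    hint ((hrpow α).mul (hφ.continuous.pow 2).continuousOn) hC0
  rw [hset hA0, hset hB0, hset hC0]
  set Ψ : EuclideanSpace ℝ (Fin (m + 2)) → ℝ :=
    fun x => φ x ^ 2 * radialHardyWeight m α ‖x‖ with hΨdef
  have hΨsub : tsupport Ψ ⊆ tsupport φ :=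
    closure_minimal (fun x hx => by_contra fun h => hx (by simp [hΨdef, hφ0 x h]))
      (isClosed_tsupport φ)
  have hΨc : HasCompactSupport Ψ := hc.of_isClosed_subset (isClosed_tsupport Ψ) hΨsub
  have hΨ : ContDiff ℝ 1 Ψ := by
    refine contDiff_iff_contDiffAt.2 fun x => ?_
    by_cases hx : x ∈ tsupport φ
    · have hxU := hsupp hx
      exact ((hφ.of_le (by simp)).contDiffAt.pow 2).mul
        ((contDiffAt_radialHardyWeight m α (hpos hxU) (hlt hxU)).comp x
          (contDiffAt_norm ℝ (norm_pos_iff.1 (hpos hxU))))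
    · exact contDiffAt_const.congr_of_eventuallyEq
        (notMem_tsupport_iff_eventuallyEq.1 fun h => hx (hΨsub h))
  have hD : Integrable fun x => fderiv ℝ Ψ x x :=
    Continuous.integrable_of_hasCompactSupport
      ((hΨ.continuous_fderiv one_ne_zero).clm_apply continuous_id)
      ((hΨc.fderiv ℝ).mono fun x hx h => hx (by simp [h]))
  have hΨint : Integrable Ψ := hΨ.continuous.integrable_of_hasCompactSupport hΨc
  have heuler := integral_fderiv_apply_self_of_hasCompactSupport hΨ hΨc
  have hpt (x : EuclideanSpace ℝ (Fin (m + 2))) :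
      k ^ 2 * (dH x ^ (α - 2) * φ x ^ 2 * pc x ^ (m + 2)) +
        k * (m + 1) / 4 * 2 ^ m * (dH x ^ α * φ x ^ 2) ≤
      dH x ^ α * ‖gradient φ x‖ ^ 2 * pc x ^ m +
        k * (fderiv ℝ Ψ x x + ((m + 2 : ℕ) : ℝ) * Ψ x) := by
    by_cases hx : x ∈ tsupport φ
    swap
    · rw [hA0 x hx, hB0 x hx, hC0 x hx, fderiv_of_notMem_tsupport ℝ fun h => hx (hΨsub h)]
      simp [hΨdef, hφ0 x hx]
    have hxU := hsupp hx
    have hr0 := hpos hxU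
    have hr1 := hlt hxU
    have hnorm : DifferentiableAt ℝ (fun x : EuclideanSpace ℝ (Fin (m + 2)) => ‖x‖) x :=
      (contDiffAt_norm ℝ (norm_pos_iff.1 hr0)).differentiableAt one_ne_zero
    have hderiv : fderiv ℝ Ψ x =
        φ x ^ 2 • (dH x ^ (α - 2) * pc x ^ (m + 1) / ‖x‖ * ((α - 1) * pc x +
          dH x * ((m + 1) * pc x * ‖x‖ - 1 / ‖x‖))) • fderiv ℝ (fun x => ‖x‖) x +
        (dH x ^ (α - 1) * pc x ^ (m + 1) / ‖x‖) • (2 • φ x ^ (2 - 1)) • fderiv ℝ φ x :=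
      (((hφ.differentiable (by simp) x).hasFDerivAt.pow 2).mul
      ((hasDerivAt_radialHardyWeight m α hr0 hr1).comp_hasFDerivAt x hnorm.hasFDerivAt)).fderiv
    have hpm : 2 ^ m ≤ pc x ^ m := by
      gcongr
      rw [pc, le_div_iff₀ (hq hxU)]
      nlinarith [sq_nonneg ‖x‖]
    have hpe : pc x * (1 - ‖x‖ ^ 2) = 2 := div_mul_cancel₀ _ (hq hxU).ne'
    have hp0 : 0 < pc x := div_pos two_pos (hq hxU)
    have hW0 : 0 < dH x ^ (α - 2) := Real.rpow_pos_of_pos (hd0 hxU) _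
    have e1 : dH x ^ (α - 1) = dH x ^ (α - 2) * dH x := by
      rw [← Real.rpow_add_one (hd0 hxU).ne']
      ring_nf
    have e2 : dH x ^ α = dH x ^ (α - 2) * dH x ^ 2 := by
      rw [← Real.rpow_natCast, ← Real.rpow_add (hd0 hxU)]
      ring_nf
    have hy : |fderiv ℝ φ x x| ≤ ‖gradient φ x‖ * ‖x‖ := by
      rw [← inner_gradient_left]
      exact abs_real_inner_le_norm _ _
    have hmain := hardy_pointwise (W := dH x ^ (α - 2) * pc x ^ m) (N := m + 1) (α := α)
      (k := k) (d := dH x) (v := φ x) (by positivity) (by positivity) hk0.le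
      (by rw [hk]; push_cast; ring) hr0 hpe
      (two_mul_le_log_one_add_div_one_sub hr0.le hr1) (log_one_add_div_one_sub_le hr0.le hr1)
      (norm_nonneg _) hy
    have hstep : k * (m + 1) / 4 * 2 ^ m * (dH x ^ α * φ x ^ 2) ≤
        k * (m + 1) / 4 * pc x ^ m * (dH x ^ α * φ x ^ 2) := by
      have := (Real.rpow_pos_of_pos (hd0 hxU) α).le
      gcongr
    have hfd : fderiv ℝ Ψ x x = 2 * φ x * fderiv ℝ φ x x *
          (dH x ^ (α - 2) * dH x * pc x ^ (m + 1) / ‖x‖) +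
        φ x ^ 2 * (dH x ^ (α - 2) * pc x ^ (m + 1) * ((α - 1) * pc x +
          dH x * ((m + 1) * pc x * ‖x‖ - 1 / ‖x‖))) := by
      rw [hderiv, e1]
      simp only [add_apply, smul_apply, hnorm.fderiv_norm_self,
        smul_eq_mul, nsmul_eq_mul]
      push_cast
      field_simp
      ring
    have hΨx : Ψ x = φ x ^ 2 * (dH x ^ (α - 2) * dH x * pc x ^ (m + 1) / ‖x‖) := by
      rw [← e1]
      rfl
    rw [hfd, hΨx]
    rw [e2] at hstep ⊢
    push_cast
    linear_combination hmain + hstep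
  have hE : Integrable fun x => k * (fderiv ℝ Ψ x x + ((m + 2 : ℕ) : ℝ) * Ψ x) :=
    (hD.add (hΨint.const_mul _)).const_mul k
  have hle := integral_mono ((hB.const_mul (k ^ 2)).add
    (hC.const_mul (k * (m + 1) / 4 * 2 ^ m))) (hA.add hE) hpt
  simp only [Pi.add_apply] at hle
  rw [integral_add (hB.const_mul _) (hC.const_mul _), integral_add hA hE,
    integral_const_mul, integral_const_mul, integral_const_mul,
    integral_add hD (hΨint.const_mul _), integral_const_mul, heuler] at hle
  linarith
end

section
/- Let n ≥ 2 and α ∈ ℝ with n + α − 2 > 0, let Bⁿ = {x ∈ ℝⁿ : |x| < 1}, p(x) = 2/(1−|x|²), and d(x) = log((1+|x|)/(1−|x|)). Then the constant ((n+α−2)/2)² is sharp in the weighted hyperbolic Hardy inequality; that is, the infimum over all nonzero compactly supported smooth functions φ on Bⁿ \ {0} of the quotient ( ∫_{Bⁿ} d^α |∇φ|² p^{n−2} dx ) / ( ∫_{Bⁿ} d^{α−2} φ² p^n dx ) equals ((n+α−2)/2)². -/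
open MeasureTheory Metric

/-- The hyperbolic distance to the origin, as a function of the Euclidean one. -/
noncomputable def hypRadius (s : ℝ) : ℝ := Real.log ((1 + s) / (1 - s))

/-- The conformal factor, as a function of the Euclidean distance to the origin. -/
noncomputable def confFactor (s : ℝ) : ℝ := 2 / (1 - s ^ 2)

theorem two_mul_le_hypRadius {s : ℝ} (h0 : 0 ≤ s) (h1 : s < 1) : 2 * s ≤ hypRadius s := by
  have := Real.sum_range_le_log_div h0 h1 1
  simp at this
  unfold hypRadius
  linarith

theorem hypRadius_le_four_mul {s : ℝ} (h0 : 0 ≤ s) (h1 : s ≤ 1 / 2) : hypRadius s ≤ 4 * s := by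
  have h : 0 < 1 - s := by linarith
  refine (Real.log_le_sub_one_of_pos (by positivity)).trans ?_
  rw [sub_le_iff_le_add, div_le_iff₀ h]
  nlinarith

theorem hypRadius_pos {s : ℝ} (h0 : 0 < s) (h1 : s < 1) : 0 < hypRadius s :=
  (by positivity : 0 < 2 * s).trans_le (two_mul_le_hypRadius h0.le h1)

theorem confFactor_pos {s : ℝ} (h0 : 0 ≤ s) (h1 : s < 1) : 0 < confFactor s :=
  div_pos two_pos (by nlinarith)

theorem two_le_confFactor {s : ℝ} (h0 : 0 ≤ s) (h1 : s < 1) : 2 ≤ confFactor s := by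
  rw [confFactor, le_div_iff₀ (by nlinarith)]
  nlinarith

theorem confFactor_le_four {s : ℝ} (h0 : 0 ≤ s) (h1 : s ≤ 1 / 2) : confFactor s ≤ 4 := by
  rw [confFactor, div_le_iff₀ (by nlinarith)]
  nlinarith

theorem hasDerivAt_hypRadius {s : ℝ} (h0 : 0 ≤ s) (h1 : s < 1) :
    HasDerivAt hypRadius (confFactor s) s := by
  have h2 : 1 - s ≠ 0 := by linarith
  have h3 : 1 + s ≠ 0 := by linarith
  have h4 : 1 - s ^ 2 ≠ 0 := by nlinarith
  have h : HasDerivAt hypRadius _ s :=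
    (((hasDerivAt_id' s).const_add 1).div ((hasDerivAt_id' s).const_sub 1) h2).log
      (div_ne_zero h3 h2)
  refine h.congr_deriv ?_
  simp only [confFactor, Pi.div_apply]
  field_simp
  ring

theorem hasDerivAt_confFactor {s : ℝ} (h0 : 0 ≤ s) (h1 : s < 1) :
    HasDerivAt confFactor (s * confFactor s ^ 2) s := by
  have h4 : 1 - s ^ 2 ≠ 0 := by nlinarith
  have h : HasDerivAt confFactor _ s :=
    (hasDerivAt_const s (2 : ℝ)).div ((hasDerivAt_pow 2 s).const_sub 1) h4
  refine h.congr_deriv ?_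
  simp only [confFactor]
  field_simp
  ring

theorem contDiffAt_hypRadius {s : ℝ} (h0 : 0 ≤ s) (h1 : s < 1) {k : WithTop ℕ∞} :
    ContDiffAt ℝ k hypRadius s := by
  have h2 : 1 - s ≠ 0 := by linarith
  have h3 : 1 + s ≠ 0 := by linarith
  exact ((contDiffAt_const.add contDiffAt_id).div (contDiffAt_const.sub contDiffAt_id) h2).log
    (div_ne_zero h3 h2)

theorem contDiffAt_confFactor {s : ℝ} (h0 : 0 ≤ s) (h1 : s < 1) {k : WithTop ℕ∞} :
    ContDiffAt ℝ k confFactor s :=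
  contDiffAt_const.div (contDiffAt_const.sub (contDiffAt_id.pow 2)) (by simp; nlinarith)

/-- The inequality `1 ≤ r coth r` in Euclidean coordinates. -/
theorem mul_confFactor_le {s : ℝ} (h0 : 0 ≤ s) (h1 : s < 1) :
    s * confFactor s ≤ hypRadius s * (1 + s ^ 2 * confFactor s) := by
  have h := two_mul_le_hypRadius h0 h1
  have h4 : 0 < 1 - s ^ 2 := by nlinarith
  have e : 1 + s ^ 2 * confFactor s = (1 + s ^ 2) / (1 - s ^ 2) := by
    simp only [confFactor]; field_simp; ring
  rw [e, confFactor, ← mul_div_assoc, ← mul_div_assoc]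
  refine div_le_div_of_nonneg_right ?_ h4.le
  nlinarith [mul_nonneg (h0.trans (by linarith : s ≤ hypRadius s)) (sq_nonneg s)]

/-- The density of the radial vector field `d ^ (α - 1) p ^ (n - 1) x / |x|`, for `n = m + 2`. -/
noncomputable def fieldDensity (m : ℕ) (α s : ℝ) : ℝ :=
  hypRadius s ^ (α - 1) * confFactor s ^ (m + 1) / s

theorem hasDerivAt_fieldDensity (m : ℕ) (α : ℝ) {s : ℝ} (h0 : 0 < s) (h1 : s < 1) :
    HasDerivAt (fieldDensity m α)
      (hypRadius s ^ (α - 2) * confFactor s ^ (m + 1) / s *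
        ((α - 1) * confFactor s + (m + 1) * hypRadius s * s * confFactor s - hypRadius s / s)) s := by
  have hr := hypRadius_pos h0 h1
  have h : HasDerivAt (fieldDensity m α) _ s :=
    (((hasDerivAt_hypRadius h0.le h1).rpow_const (p := α - 1) (Or.inl hr.ne')).mul
      ((hasDerivAt_confFactor h0.le h1).pow (m + 1))).div (hasDerivAt_id' s) h0.ne'
  refine h.congr_deriv ?_
  have e1 : hypRadius s ^ (α - 1) = hypRadius s ^ (α - 2) * hypRadius s := by
    rw [← Real.rpow_add_one hr.ne']; ring_nf
  have e2 : α - 1 - 1 = α - 2 := by ring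
  simp only [e1, e2, Pi.mul_apply, Pi.pow_apply]
  push_cast
  field_simp
  ring

theorem contDiffAt_fieldDensity (m : ℕ) (α : ℝ) {s : ℝ} (h0 : 0 < s) (h1 : s < 1)
    {k : WithTop ℕ∞} : ContDiffAt ℝ k (fieldDensity m α) s :=
  (((contDiffAt_hypRadius h0.le h1).rpow_const_of_ne (hypRadius_pos h0 h1).ne').mul
    ((contDiffAt_confFactor h0.le h1).pow _)).div contDiffAt_id h0.ne'

section Euclidean

variable {n : ℕ}

/-- A function `H` on `ℝⁿ` with compact support satisfies `∫ div (H x) = 0`. -/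
theorem integral_radial_div_eq_zero {H : EuclideanSpace ℝ (Fin n) → ℝ} (hH : ContDiff ℝ 1 H)
    (hc : HasCompactSupport H) :
    Integrable (fun x => n * H x + fderiv ℝ H x x) ∧ ∫ x, (n * H x + fderiv ℝ H x x) = 0 := by
  have hd : Continuous (fderiv ℝ H) := hH.continuous_fderiv one_ne_zero
  have hdc : HasCompactSupport (fderiv ℝ H) := hc.fderiv ℝ
  have key (v : EuclideanSpace ℝ (Fin n)) (i : Fin n) :
      Integrable (fun x : EuclideanSpace ℝ (Fin n) => x i * fderiv ℝ H x v) := by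
    refine Continuous.integrable_of_hasCompactSupport (by fun_prop) ?_
    exact (hdc.comp_left (g := fun L : EuclideanSpace ℝ (Fin n) →L[ℝ] ℝ => L v) rfl).mul_left
  have hI : Integrable H := hH.continuous.integrable_of_hasCompactSupport hc
  have hproj (i : Fin n) (x : EuclideanSpace ℝ (Fin n)) :
      fderiv ℝ (fun y : EuclideanSpace ℝ (Fin n) => y i) x = EuclideanSpace.proj i :=
    (EuclideanSpace.proj (𝕜 := ℝ) i : EuclideanSpace ℝ (Fin n) →L[ℝ] ℝ).fderiv
  have ibp (i : Fin n) : ∫ x : EuclideanSpace ℝ (Fin n),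
      x i * fderiv ℝ H x (EuclideanSpace.single i 1) = - ∫ x, H x := by
    rw [integral_mul_fderiv_eq_neg_fderiv_mul_of_integrable]
    · simp [hproj]
    · simpa [hproj] using hI
    · exact key _ i
    · refine Continuous.integrable_of_hasCompactSupport ?_ hc.mul_left
      have := hH.continuous
      fun_prop
    · intro x _; fun_prop
    · intro x _; exact hH.differentiable one_ne_zero x
  have hsum (x : EuclideanSpace ℝ (Fin n)) : fderiv ℝ H x x =
      ∑ i, x i * fderiv ℝ H x (EuclideanSpace.single i 1) := by
    have h := congrArg (fderiv ℝ H x) ((EuclideanSpace.basisFun (Fin n) ℝ).sum_repr x)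
    simpa [map_sum] using h.symm
  have hI2 : Integrable (fun x => fderiv ℝ H x x) := by
    simp only [hsum]
    exact integrable_finsetSum _ fun i _ => key _ i
  refine ⟨(hI.const_mul _).add hI2, ?_⟩
  rw [integral_add (hI.const_mul _) hI2, integral_const_mul]
  simp only [hsum]
  rw [integral_finsetSum _ fun i _ => key _ i]
  simp [ibp]

theorem norm_gradient_eq_norm_fderiv (φ : EuclideanSpace ℝ (Fin n) → ℝ)
    (x : EuclideanSpace ℝ (Fin n)) : ‖gradient φ x‖ = ‖fderiv ℝ φ x‖ := by
  simp [gradient]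

theorem norm_mem_of_mem_punctured_ball {x : EuclideanSpace ℝ (Fin n)}
    (hx : x ∈ ball (0 : EuclideanSpace ℝ (Fin n)) 1 \ {0}) : 0 < ‖x‖ ∧ ‖x‖ < 1 := by
  simpa [and_comm] using hx

/-- A continuous function supported in the punctured ball may be multiplied by a radial weight that
is only continuous there. -/
theorem continuous_radial_mul {w : ℝ → ℝ} (hw : ∀ s, 0 < s → s < 1 → ContinuousAt w s)
    {g : EuclideanSpace ℝ (Fin n) → ℝ} (hg : Continuous g) (hc : HasCompactSupport g)
    (hs : tsupport g ⊆ ball (0 : EuclideanSpace ℝ (Fin n)) 1 \ {0}) :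
    Continuous (fun x => w ‖x‖ * g x) ∧ HasCompactSupport (fun x => w ‖x‖ * g x) := by
  refine ⟨continuous_of_tsupport fun x hx => ?_, hc.mul_left⟩
  obtain ⟨h0, h1⟩ := norm_mem_of_mem_punctured_ball (hs (tsupport_mul_subset_right hx))
  exact (ContinuousAt.comp (f := norm) (hw _ h0 h1) continuous_norm.continuousAt).mul
    hg.continuousAt

end Euclidean

section LowerBound

/-- The pointwise estimate behind the Hardy inequality: `s`, `d`, `p`, `E` are the values of `|x|`,
the hyperbolic distance, the conformal factor and `d ^ (α - 2)`, while `u`, `g`, `D` are the values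
of the function, the norm of its gradient and its derivative in the direction `x`. -/
theorem hardy_pointwise_s14 {m : ℕ} {c α s d p E u g D : ℝ} (hc : 0 < c) (hcα : 2 * c = m + α)
    (hs : 0 < s) (hd : 0 < d) (hp : 0 < p) (hE : 0 < E) (hD : |D| ≤ g * s)
    (h : s * p ≤ d * (1 + s ^ 2 * p)) :
    c * (E * u ^ 2 * p ^ (m + 2)) ≤ c⁻¹ * (E * d ^ 2 * g ^ 2 * p ^ m) +
      ((m + 2) * (E * d * p ^ (m + 1) / s * u ^ 2) +
        (s * (E * p ^ (m + 1) / s * ((α - 1) * p + (m + 1) * d * s * p - d / s)) * u ^ 2 +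
          E * d * p ^ (m + 1) / s * (2 * u * D))) := by
  have e : c⁻¹ * (E * d ^ 2 * g ^ 2 * p ^ m) +
      ((m + 2) * (E * d * p ^ (m + 1) / s * u ^ 2) +
        (s * (E * p ^ (m + 1) / s * ((α - 1) * p + (m + 1) * d * s * p - d / s)) * u ^ 2 +
          E * d * p ^ (m + 1) / s * (2 * u * D))) - c * (E * u ^ 2 * p ^ (m + 2)) =
      E * p ^ m * (p / s * u ^ 2 * (m + 1) * (d * (1 + s ^ 2 * p) - s * p) +
        (c⁻¹ * (d * g) ^ 2 + c * (p * u) ^ 2 + 2 * (d * p * u * (D / s)))) := by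
    obtain rfl : α = 2 * c - m := by linarith
    field_simp
    ring
  have hDs : |D / s| ≤ g := by
    rw [abs_div, abs_of_pos hs, div_le_iff₀ hs]; exact hD
  have hsq : 0 ≤ c⁻¹ * (d * g) ^ 2 + c * (p * u) ^ 2 + 2 * (d * p * u * (D / s)) := by
    have h1 : (D / s) ^ 2 ≤ g ^ 2 := sq_le_sq' (abs_le.1 hDs).1 (abs_le.1 hDs).2
    have h2 : c⁻¹ * (d * (D / s)) ^ 2 ≤ c⁻¹ * (d * g) ^ 2 := by
      rw [mul_pow, mul_pow]; gcongr
    have h3 : c⁻¹ * (d * (D / s)) ^ 2 + c * (p * u) ^ 2 + 2 * (d * p * u * (D / s)) =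
        c⁻¹ * (d * (D / s) + c * (p * u)) ^ 2 := by
      field_simp; ring
    have h4 : 0 ≤ c⁻¹ * (d * (D / s) + c * (p * u)) ^ 2 := by positivity
    linarith
  have hfac : 0 ≤ d * (1 + s ^ 2 * p) - s * p := by linarith
  have : 0 ≤ E * p ^ m * (p / s * u ^ 2 * (m + 1) * (d * (1 + s ^ 2 * p) - s * p) +
        (c⁻¹ * (d * g) ^ 2 + c * (p * u) ^ 2 + 2 * (d * p * u * (D / s)))) := by positivity
  linarith

variable {m : ℕ} {φ : EuclideanSpace ℝ (Fin (m + 2)) → ℝ}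

theorem contDiff_fieldDensity_mul_sq (α : ℝ) (hφ : ContDiff ℝ (⊤ : ℕ∞) φ)
    (hs : tsupport φ ⊆ ball 0 1 \ {0}) :
    ContDiff ℝ 1 (fun x => fieldDensity m α ‖x‖ * φ x ^ 2) := by
  refine contDiff_iff_contDiffAt.2 fun x => ?_
  by_cases hx : x ∈ tsupport (fun x => fieldDensity m α ‖x‖ * φ x ^ 2)
  swap
  · exact (contDiffAt_const (c := (0 : ℝ))).congr_of_eventuallyEq
      (notMem_tsupport_iff_eventuallyEq.1 hx)
  have hx' : x ∈ tsupport φ := by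
    refine tsupport_mul_subset_left (f := φ) (g := φ) ?_
    simpa [sq] using tsupport_mul_subset_right (f := fun x => fieldDensity m α ‖x‖) hx
  obtain ⟨h0, h1⟩ := norm_mem_of_mem_punctured_ball (hs hx')
  exact (ContDiffAt.comp (f := norm) x (contDiffAt_fieldDensity m α h0 h1)
    (contDiffAt_norm ℝ (norm_pos_iff.1 h0))).mul
    ((hφ.of_le (by exact_mod_cast le_top)).contDiffAt.pow 2)

theorem fderiv_fieldDensity_mul_sq_self (α : ℝ) {x : EuclideanSpace ℝ (Fin (m + 2))}
    (hφ : DifferentiableAt ℝ φ x) (h0 : 0 < ‖x‖) (h1 : ‖x‖ < 1) :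
    fderiv ℝ (fun x => fieldDensity m α ‖x‖ * φ x ^ 2) x x =
      ‖x‖ * deriv (fieldDensity m α) ‖x‖ * φ x ^ 2 +
        fieldDensity m α ‖x‖ * (2 * φ x * fderiv ℝ φ x x) := by
  have hn : DifferentiableAt ℝ (fun y : EuclideanSpace ℝ (Fin (m + 2)) => ‖y‖) x :=
    (contDiffAt_norm (n := 1) ℝ (norm_pos_iff.1 h0)).differentiableAt one_ne_zero
  have hk := (hasDerivAt_fieldDensity m α h0 h1).differentiableAt.hasDerivAt
  have h := (hk.comp_hasFDerivAt x hn.hasFDerivAt).mul (hφ.hasFDerivAt.pow 2)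
  have e := h.fderiv
  simp only [Function.comp_def] at e
  refine (congrArg (fun L => L x) e).trans ?_
  simp [hn.fderiv_norm_self]
  ring

theorem tsupport_sq_subset {X : Type*} [TopologicalSpace X] (f : X → ℝ) :
    tsupport (fun x => f x ^ 2) ⊆ tsupport f := by
  simp only [sq]
  exact tsupport_mul_subset_left

theorem continuousAt_weight (β : ℝ) (k : ℕ) {s : ℝ} (h0 : 0 < s) (h1 : s < 1) :
    ContinuousAt (fun s => hypRadius s ^ β * confFactor s ^ k) s :=
  ((contDiffAt_hypRadius (k := 0) h0.le h1).continuousAt.rpow_const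
    (Or.inl (hypRadius_pos h0 h1).ne')).mul
    ((contDiffAt_confFactor (k := 0) h0.le h1).continuousAt.pow k)

/-- The denominator of the Hardy quotient has a continuous integrand with compact support. -/
theorem continuous_potential (β : ℝ) (k : ℕ) (hφ : Continuous φ) (hc : HasCompactSupport φ)
    (hs : tsupport φ ⊆ ball 0 1 \ {0}) :
    Continuous (fun x => dH x ^ β * φ x ^ 2 * pc x ^ k) ∧
      HasCompactSupport (fun x => dH x ^ β * φ x ^ 2 * pc x ^ k) := by
  have hc2 : HasCompactSupport (fun x => φ x ^ 2) :=
    hc.mono' ((subset_tsupport _).trans (tsupport_sq_subset φ))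
  have h := continuous_radial_mul (fun s h0 h1 => continuousAt_weight β k h0 h1)
    (hφ.pow 2) hc2 ((tsupport_sq_subset φ).trans hs)
  have e : (fun x => dH x ^ β * φ x ^ 2 * pc x ^ k) =
      fun x => hypRadius ‖x‖ ^ β * confFactor ‖x‖ ^ k * φ x ^ 2 := by
    ext x; simp only [dH, pc, hypRadius, confFactor]; ring
  rw [e]
  exact h

/-- The numerator of the Hardy quotient has a continuous integrand with compact support. -/
theorem continuous_energy (β : ℝ) (k : ℕ) (hφ : ContDiff ℝ (⊤ : ℕ∞) φ)
    (hc : HasCompactSupport φ) (hs : tsupport φ ⊆ ball 0 1 \ {0}) :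
    Continuous (fun x => dH x ^ β * ‖gradient φ x‖ ^ 2 * pc x ^ k) ∧
      HasCompactSupport (fun x => dH x ^ β * ‖gradient φ x‖ ^ 2 * pc x ^ k) := by
  have h1 : Continuous (fun x => ‖fderiv ℝ φ x‖) := (hφ.continuous_fderiv (by simp)).norm
  have hsub : tsupport (fun x => ‖fderiv ℝ φ x‖) ⊆ ball 0 1 \ {0} := by
    refine (closure_mono ?_).trans ((tsupport_fderiv_subset ℝ).trans hs)
    intro x; simp
  have h := continuous_potential β k h1 (hc.fderiv ℝ).norm hsub
  simpa only [norm_gradient_eq_norm_fderiv] using h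

/-- The weighted hyperbolic Hardy inequality. -/
theorem hardy_inequality (α : ℝ) {c : ℝ} (hc0 : 0 < c) (hcα : 2 * c = m + α)
    (hφ : ContDiff ℝ (⊤ : ℕ∞) φ) (hc : HasCompactSupport φ) (hs : tsupport φ ⊆ ball 0 1 \ {0}) :
    c ^ 2 * ∫ x in ball (0 : EuclideanSpace ℝ (Fin (m + 2))) 1,
        dH x ^ (α - 2) * φ x ^ 2 * pc x ^ (m + 2) ≤
      ∫ x in ball (0 : EuclideanSpace ℝ (Fin (m + 2))) 1,
        dH x ^ α * ‖gradient φ x‖ ^ 2 * pc x ^ m := by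
  set H : EuclideanSpace ℝ (Fin (m + 2)) → ℝ := fun x => fieldDensity m α ‖x‖ * φ x ^ 2 with hH
  have hHsub : tsupport H ⊆ tsupport φ :=
    tsupport_mul_subset_right.trans (tsupport_sq_subset φ)
  have hHc : HasCompactSupport H := hc.mono' ((subset_tsupport _).trans hHsub)
  obtain ⟨hI, h0⟩ := integral_radial_div_eq_zero (contDiff_fieldDensity_mul_sq α hφ hs) hHc
  have hA := (continuous_potential (α - 2) (m + 2) hφ.continuous hc hs)
  have hB := (continuous_energy α m hφ hc hs)
  have hAI := hA.1.integrable_of_hasCompactSupport (μ := volume) hA.2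
  have hBI := hB.1.integrable_of_hasCompactSupport (μ := volume) hB.2
  rw [← hH] at hI h0
  have hset : ∫ x in ball (0 : EuclideanSpace ℝ (Fin (m + 2))) 1,
      (((m + 2 : ℕ) : ℝ) * H x + fderiv ℝ H x x) = 0 := by
    rw [setIntegral_eq_integral_of_forall_compl_eq_zero, h0]
    intro x hx
    have hx' : x ∉ tsupport H := fun h => hx (hs (hHsub h)).1
    rw [image_eq_zero_of_notMem_tsupport hx', fderiv_of_notMem_tsupport ℝ hx']
    simp
  have hmono : c * ∫ x in ball (0 : EuclideanSpace ℝ (Fin (m + 2))) 1,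
        dH x ^ (α - 2) * φ x ^ 2 * pc x ^ (m + 2) ≤
      c⁻¹ * (∫ x in ball (0 : EuclideanSpace ℝ (Fin (m + 2))) 1,
        dH x ^ α * ‖gradient φ x‖ ^ 2 * pc x ^ m) + 0 := by
    rw [← hset, ← integral_const_mul, ← integral_const_mul,
      ← integral_add (hBI.integrableOn.const_mul _) hI.integrableOn]
    refine setIntegral_mono_on (hAI.integrableOn.const_mul _)
      ((hBI.integrableOn.const_mul _).add hI.integrableOn) measurableSet_ball fun x hx => ?_
    rcases eq_or_ne x 0 with rfl | hx0
    · have hφ0 : φ 0 = 0 := image_eq_zero_of_notMem_tsupport fun h => (hs h).2 rfl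
      have : 0 ≤ c⁻¹ * (dH (0 : EuclideanSpace ℝ (Fin (m + 2))) ^ α * ‖gradient φ 0‖ ^ 2 *
          pc (0 : EuclideanSpace ℝ (Fin (m + 2))) ^ m) := by
        simp only [dH, pc, norm_zero]
        norm_num
        positivity
      simpa [hH, hφ0] using this
    · obtain ⟨hx1, hx2⟩ := norm_mem_of_mem_punctured_ball (x := x) ⟨hx, hx0⟩
      have hd := hypRadius_pos hx1 hx2
      have hD : |fderiv ℝ φ x x| ≤ ‖gradient φ x‖ * ‖x‖ := by
        rw [norm_gradient_eq_norm_fderiv]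
        exact (fderiv ℝ φ x).le_opNorm x
      have e1 : hypRadius ‖x‖ ^ (α - 1) = hypRadius ‖x‖ ^ (α - 2) * hypRadius ‖x‖ := by
        rw [← Real.rpow_add_one hd.ne']; ring_nf
      have e2 : hypRadius ‖x‖ ^ α = hypRadius ‖x‖ ^ (α - 2) * hypRadius ‖x‖ ^ 2 := by
        rw [← Real.rpow_add_natCast hd.ne']; norm_num
      have key := hardy_pointwise_s14 (u := φ x) hc0 hcα hx1 hd (confFactor_pos hx1.le hx2)
        (Real.rpow_pos_of_pos hd (α - 2)) hD (mul_confFactor_le hx1.le hx2)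
      rw [fderiv_fieldDensity_mul_sq_self α (hφ.differentiable (by simp) x) hx1 hx2,
        (hasDerivAt_fieldDensity m α hx1 hx2).deriv]
      simp only [fieldDensity, e1]
      change c * (hypRadius ‖x‖ ^ (α - 2) * φ x ^ 2 * confFactor ‖x‖ ^ (m + 2)) ≤
        c⁻¹ * (hypRadius ‖x‖ ^ α * ‖gradient φ x‖ ^ 2 * confFactor ‖x‖ ^ m) + _
      rw [e2]
      push_cast
      exact key
  rw [add_zero, inv_mul_eq_div, le_div_iff₀ hc0] at hmono
  linarith

/-- The denominator of the Hardy quotient is positive. -/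
theorem potential_integral_pos (β : ℝ) (k : ℕ) (hφ : Continuous φ) (hc : HasCompactSupport φ)
    (hs : tsupport φ ⊆ ball 0 1 \ {0}) (hne : φ ≠ 0) :
    0 < ∫ x in ball (0 : EuclideanSpace ℝ (Fin (m + 2))) 1, dH x ^ β * φ x ^ 2 * pc x ^ k := by
  have hA := continuous_potential β k hφ hc hs
  have hz (x) (hx : x ∉ tsupport φ) : φ x = 0 := image_eq_zero_of_notMem_tsupport hx
  have hpos (x) (hx : x ∈ tsupport φ) : 0 < dH x ^ β ∧ 0 < pc x ^ k := by
    obtain ⟨h0, h1⟩ := norm_mem_of_mem_punctured_ball (hs hx)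
    exact ⟨Real.rpow_pos_of_pos (hypRadius_pos h0 h1) _, pow_pos (confFactor_pos h0.le h1) _⟩
  rw [setIntegral_eq_integral_of_forall_compl_eq_zero]
  · obtain ⟨x, hx⟩ := Function.ne_iff.1 hne
    refine hA.1.integral_pos_of_hasCompactSupport_nonneg_nonzero hA.2 (fun y => ?_) (x := x) ?_
    · by_cases hy : y ∈ tsupport φ
      · have := hpos y hy
        exact mul_nonneg (mul_nonneg this.1.le (sq_nonneg _)) this.2.le
      · simp [hz y hy]
    · have hx' : φ x ≠ 0 := hx
      have := hpos x (subset_tsupport _ hx')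
      exact mul_ne_zero (mul_ne_zero this.1.ne' (pow_ne_zero _ hx')) this.2.ne'
  · intro x hx
    simp [hz x fun h => hx (hs h).1]

end LowerBound

section UpperBound

theorem exists_plateau : ∃ (χ : ℝ → ℝ) (M : ℝ), ContDiff ℝ (⊤ : ℕ∞) χ ∧
    (∀ t, -3 ≤ t → t ≤ -2 → χ t = 1) ∧ (∀ t, χ t ≠ 0 → -4 ≤ t ∧ t ≤ -1) ∧
    ∀ t, |deriv χ t| ≤ M := by
  let f : ContDiffBump (-5 / 2 : ℝ) := ⟨1 / 2, 3 / 2, by norm_num, by norm_num⟩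
  have hf : ContDiff ℝ (⊤ : ℕ∞) f := f.contDiff
  obtain ⟨M, hM⟩ := f.hasCompactSupport.deriv.exists_bound_of_continuous
    (hf.continuous_deriv (by simp))
  refine ⟨f, M, hf, fun t h1 h2 => f.one_of_mem_closedBall ?_, fun t ht => ?_, hM⟩
  · rw [Real.closedBall_eq_Icc]
    constructor <;> simp only [f] <;> linarith
  · have h : t ∈ Function.support f := ht
    rw [f.support_eq, Real.ball_eq_Ioo] at h
    obtain ⟨h1, h2⟩ := h
    simp only [f] at h1 h2
    constructor <;> linarith

/-- The radial profile of the test functions: the virtual minimizer `d ^ (-c)` cut off at two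
scales close to the origin. -/
noncomputable def testProfile (χ : ℝ → ℝ) (c L s : ℝ) : ℝ :=
  hypRadius s ^ (-c) * χ (Real.log s / L)

theorem contDiffAt_testProfile {χ : ℝ → ℝ} (hχ : ContDiff ℝ (⊤ : ℕ∞) χ) (c L : ℝ) {s : ℝ}
    (h0 : 0 < s) (h1 : s < 1) : ContDiffAt ℝ (⊤ : ℕ∞) (testProfile χ c L) s :=
  ((contDiffAt_hypRadius h0.le h1).rpow_const_of_ne (hypRadius_pos h0 h1).ne').mul
    (hχ.contDiffAt.comp s ((Real.contDiffAt_log.2 h0.ne').div_const L))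

theorem hasDerivAt_testProfile {χ : ℝ → ℝ} (hχ : Differentiable ℝ χ) (c L : ℝ) {s : ℝ}
    (h0 : 0 < s) (h1 : s < 1) :
    HasDerivAt (testProfile χ c L)
      (hypRadius s ^ (-c) * (-(c * (confFactor s / hypRadius s) * χ (Real.log s / L)) +
        deriv χ (Real.log s / L) / (L * s))) s := by
  have hr := hypRadius_pos h0 h1
  have h : HasDerivAt (testProfile χ c L) _ s :=
    ((hasDerivAt_hypRadius h0.le h1).rpow_const (p := -c) (Or.inl hr.ne')).mul
      ((hχ _).hasDerivAt.comp s ((Real.hasDerivAt_log h0.ne').div_const L))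
  refine h.congr_deriv ?_
  rw [Real.rpow_sub_one hr.ne']
  field_simp

theorem norm_gradient_radial_le {n : ℕ} {f : ℝ → ℝ} {f' : ℝ} {x : EuclideanSpace ℝ (Fin n)}
    (hx : x ≠ 0) (hf : HasDerivAt f f' ‖x‖) : ‖gradient (fun y => f ‖y‖) x‖ ≤ |f'| := by
  have hn : DifferentiableAt ℝ (fun y : EuclideanSpace ℝ (Fin n) => ‖y‖) x :=
    (contDiffAt_norm (n := 1) ℝ hx).differentiableAt one_ne_zero
  have h : fderiv ℝ (fun y : EuclideanSpace ℝ (Fin n) => f ‖y‖) x = f' • fderiv ℝ (‖·‖) x :=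
    (hf.comp_hasFDerivAt x hn.hasFDerivAt).fderiv
  have h1 : ‖fderiv ℝ (fun y : EuclideanSpace ℝ (Fin n) => ‖y‖) x‖ ≤ 1 := by
    simpa using norm_fderiv_le_of_lipschitz ℝ (x₀ := x)
      (lipschitzWith_one_norm (E := EuclideanSpace ℝ (Fin n)))
  rw [norm_gradient_eq_norm_fderiv, h, norm_smul, Real.norm_eq_abs]
  exact mul_le_of_le_one_right (abs_nonneg _) h1

/-- The scale invariant weight `|x| ^ (-n)`, restricted to an annulus. -/
noncomputable def annulusWeight (n : ℕ) (a b s : ℝ) : ℝ :=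
  (Set.Icc a b).indicator (fun s => (s ^ n)⁻¹) s

theorem annulusWeight_nonneg {n : ℕ} {a : ℝ} (b : ℝ) (ha : 0 < a) (s : ℝ) :
    0 ≤ annulusWeight n a b s := by
  refine Set.indicator_nonneg (fun s hs => ?_) s
  have := ha.trans_le hs.1
  positivity

theorem integral_annulusWeight (m : ℕ) {a b : ℝ} (ha : 0 < a) (hab : a ≤ b) :
    Integrable (fun x : EuclideanSpace ℝ (Fin (m + 2)) => annulusWeight (m + 2) a b ‖x‖) ∧
      ∫ x : EuclideanSpace ℝ (Fin (m + 2)), annulusWeight (m + 2) a b ‖x‖ =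
        (m + 2) * volume.real (ball (0 : EuclideanSpace ℝ (Fin (m + 2))) 1) * Real.log (b / a) := by
  have e (y : ℝ) : y ^ (m + 1) • annulusWeight (m + 2) a b y =
      (Set.Icc a b).indicator (fun y => y⁻¹) y := by
    by_cases hy : y ∈ Set.Icc a b
    · have := ha.trans_le hy.1
      simp only [annulusWeight, hy, Set.indicator_of_mem, smul_eq_mul]
      field_simp
      ring
    · simp [annulusWeight, hy]
  have hsub : Set.Icc a b ⊆ Set.Ioi 0 := fun y hy => ha.trans_le hy.1
  have hf : Module.finrank ℝ (EuclideanSpace ℝ (Fin (m + 2))) - 1 = m + 1 := by simp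
  constructor
  · rw [integrable_fun_norm_addHaar (μ := volume) (f := annulusWeight (m + 2) a b), hf]
    simp only [e]
    refine Integrable.integrableOn ?_
    rw [integrable_indicator_iff measurableSet_Icc]
    exact ContinuousOn.integrableOn_Icc (continuousOn_id.inv₀ fun y hy => (hsub hy).ne')
  · rw [integral_fun_norm_addHaar (μ := volume) (annulusWeight (m + 2) a b), hf]
    simp only [e]
    rw [setIntegral_indicator measurableSet_Icc, Set.inter_eq_right.2 hsub,
      integral_Icc_eq_integral_Ioc, ← intervalIntegral.integral_of_le hab,
      integral_inv_of_pos ha (ha.trans_le hab)]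
    simp [mul_assoc]

variable {m : ℕ} {χ : ℝ → ℝ} {M : ℝ}

theorem exp_le_of_plateau {χ : ℝ → ℝ} (hsupp : ∀ t, χ t ≠ 0 → -4 ≤ t ∧ t ≤ -1) {c L s : ℝ}
    (hL : 1 ≤ L) (hs : 0 ≤ s) (h : testProfile χ c L s ≠ 0) :
    Real.exp (-4 * L) ≤ s ∧ s ≤ Real.exp (-L) := by
  have hL0 : 0 < L := by linarith
  obtain ⟨h1, h2⟩ := hsupp _ (right_ne_zero_of_mul h)
  rw [le_div_iff₀ hL0] at h1
  rw [div_le_iff₀ hL0] at h2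
  have hs0 : 0 < s := by
    rcases hs.eq_or_lt with rfl | h
    · simp at h2; linarith
    · exact h
  exact ⟨(Real.le_log_iff_exp_le hs0).1 h1, (Real.log_le_iff_le_exp hs0).1 (by linarith)⟩

theorem exp_neg_le_half {L : ℝ} (hL : 1 ≤ L) : Real.exp (-L) ≤ 1 / 2 := by
  rw [Real.exp_neg, one_div]
  have := Real.add_one_le_exp L
  gcongr
  linarith

theorem tsupport_testProfile_subset (m : ℕ) (hsupp : ∀ t, χ t ≠ 0 → -4 ≤ t ∧ t ≤ -1) (c : ℝ)
    {L : ℝ} (hL : 1 ≤ L) :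
    tsupport (fun x : EuclideanSpace ℝ (Fin (m + 2)) => testProfile χ c L ‖x‖) ⊆
      {x | Real.exp (-4 * L) ≤ ‖x‖ ∧ ‖x‖ ≤ Real.exp (-L)} := by
  refine closure_minimal (fun x hx => exp_le_of_plateau hsupp hL (norm_nonneg x) hx) ?_
  exact (isClosed_le continuous_const continuous_norm).inter
    (isClosed_le continuous_norm continuous_const)

theorem testProfile_admissible (m : ℕ) (hχ : ContDiff ℝ (⊤ : ℕ∞) χ)
    (hsupp : ∀ t, χ t ≠ 0 → -4 ≤ t ∧ t ≤ -1) (c : ℝ) {L : ℝ} (hL : 1 ≤ L) :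
    ContDiff ℝ (⊤ : ℕ∞) (fun x : EuclideanSpace ℝ (Fin (m + 2)) => testProfile χ c L ‖x‖) ∧
      HasCompactSupport (fun x : EuclideanSpace ℝ (Fin (m + 2)) => testProfile χ c L ‖x‖) ∧
      tsupport (fun x : EuclideanSpace ℝ (Fin (m + 2)) => testProfile χ c L ‖x‖) ⊆
        ball 0 1 \ {0} := by
  have hK := tsupport_testProfile_subset m hsupp c hL
  have hmem (x : EuclideanSpace ℝ (Fin (m + 2))) (hx : x ∈ tsupport
      (fun x : EuclideanSpace ℝ (Fin (m + 2)) => testProfile χ c L ‖x‖)) : 0 < ‖x‖ ∧ ‖x‖ < 1 :=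
    ⟨(Real.exp_pos _).trans_le (hK hx).1, by linarith [(hK hx).2, exp_neg_le_half hL]⟩
  refine ⟨contDiff_iff_contDiffAt.2 fun x => ?_, ?_, fun x hx => ?_⟩
  · by_cases hx : x ∈ tsupport
      (fun x : EuclideanSpace ℝ (Fin (m + 2)) => testProfile χ c L ‖x‖)
    · obtain ⟨h0, h1⟩ := hmem x hx
      exact ContDiffAt.comp (f := norm) x (contDiffAt_testProfile hχ c L h0 h1)
        (contDiffAt_norm ℝ (norm_pos_iff.1 h0))
    · exact (contDiffAt_const (c := (0 : ℝ))).congr_of_eventuallyEq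
        (notMem_tsupport_iff_eventuallyEq.1 hx)
  · refine (isCompact_closedBall (0 : EuclideanSpace ℝ (Fin (m + 2))) 1).of_isClosed_subset
      (isClosed_tsupport _) fun x hx => ?_
    simpa using (hmem x hx).2.le
  · simpa [and_comm] using hmem x hx

/-- Up to a small error, the energy density of a test function is `c ^ 2` times the potential
density: here `q` stands for `p / d`. -/
theorem energy_error_le {m : ℕ} {c L M s q u v : ℝ} (hL : 1 ≤ L) (hs : 0 < s) (hq : 0 ≤ q)
    (hqs : q ≤ 2 / s) (hv : |v| ≤ M) :
    q ^ m * (-(c * q * u) + v / (L * s)) ^ 2 ≤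
      (1 + 1 / L) * c ^ 2 * (q ^ (m + 2) * u ^ 2) +
        2 ^ (m + 1) * M ^ 2 / L * (s ^ (m + 2))⁻¹ := by
  have hL0 : 0 < L := by linarith
  have hv2 : v ^ 2 ≤ M ^ 2 := sq_le_sq' (abs_le.1 hv).1 (abs_le.1 hv).2
  have h1 : (-(c * q * u) + v / (L * s)) ^ 2 ≤
      (1 + 1 / L) * (c * q * u) ^ 2 + (1 + L) * (v / (L * s)) ^ 2 := by
    have : (1 + 1 / L) * (c * q * u) ^ 2 + (1 + L) * (v / (L * s)) ^ 2 -
        (-(c * q * u) + v / (L * s)) ^ 2 = L * (c * q * u / L + v / (L * s)) ^ 2 := by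
      field_simp; ring
    have : 0 ≤ L * (c * q * u / L + v / (L * s)) ^ 2 := by positivity
    linarith
  have h2 : (1 + L) * (v / (L * s)) ^ 2 ≤ 2 * M ^ 2 / L * (s ^ 2)⁻¹ := by
    have : (1 + L) * (v / (L * s)) ^ 2 = (1 + L) * v ^ 2 / L ^ 2 * (s ^ 2)⁻¹ := by
      field_simp
    rw [this]
    refine mul_le_mul_of_nonneg_right ?_ (by positivity)
    rw [div_le_div_iff₀ (by positivity) hL0]
    have : (1 + L) * v ^ 2 ≤ 2 * L * M ^ 2 := by
      gcongr; linarith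
    nlinarith
  calc q ^ m * (-(c * q * u) + v / (L * s)) ^ 2
      ≤ q ^ m * ((1 + 1 / L) * (c * q * u) ^ 2 + 2 * M ^ 2 / L * (s ^ 2)⁻¹) := by
        gcongr; linarith
    _ = (1 + 1 / L) * c ^ 2 * (q ^ (m + 2) * u ^ 2) + q ^ m * (2 * M ^ 2 / L * (s ^ 2)⁻¹) := by
        ring
    _ ≤ (1 + 1 / L) * c ^ 2 * (q ^ (m + 2) * u ^ 2) +
          (2 / s) ^ m * (2 * M ^ 2 / L * (s ^ 2)⁻¹) := by
        gcongr
    _ = _ := by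
        rw [div_pow]
        field_simp
        ring

theorem potential_testProfile_eq {c α L s : ℝ} (hcα : 2 * c = m + α) (h0 : 0 < s) (h1 : s < 1) :
    hypRadius s ^ (α - 2) * testProfile χ c L s ^ 2 * confFactor s ^ (m + 2) =
      (confFactor s / hypRadius s) ^ (m + 2) * χ (Real.log s / L) ^ 2 := by
  have hd := hypRadius_pos h0 h1
  have e : hypRadius s ^ (α - 2) * (hypRadius s ^ (-c)) ^ 2 = (hypRadius s ^ (m + 2))⁻¹ := by
    rw [← Real.rpow_natCast, ← Real.rpow_natCast, ← Real.rpow_mul hd.le, ← Real.rpow_add hd,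
      ← Real.rpow_neg hd.le]
    congr 1
    push_cast
    linarith
  rw [testProfile, mul_pow, ← mul_assoc, e, div_pow]
  ring

theorem energy_testProfile_le {c α L : ℝ} (hcα : 2 * c = m + α) (hχ : Differentiable ℝ χ)
    {x : EuclideanSpace ℝ (Fin (m + 2))} (h0 : 0 < ‖x‖) (h1 : ‖x‖ < 1) :
    hypRadius ‖x‖ ^ α * ‖gradient (fun y : EuclideanSpace ℝ (Fin (m + 2)) =>
        testProfile χ c L ‖y‖) x‖ ^ 2 * confFactor ‖x‖ ^ m ≤
      (confFactor ‖x‖ / hypRadius ‖x‖) ^ m *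
        (-(c * (confFactor ‖x‖ / hypRadius ‖x‖) * χ (Real.log ‖x‖ / L)) +
          deriv χ (Real.log ‖x‖ / L) / (L * ‖x‖)) ^ 2 := by
  have hd := hypRadius_pos h0 h1
  have hp := confFactor_pos h0.le h1
  have e : hypRadius ‖x‖ ^ α * (hypRadius ‖x‖ ^ (-c)) ^ 2 = (hypRadius ‖x‖ ^ m)⁻¹ := by
    rw [← Real.rpow_natCast, ← Real.rpow_natCast, ← Real.rpow_mul hd.le, ← Real.rpow_add hd,
      ← Real.rpow_neg hd.le]
    congr 1
    push_cast
    linarith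
  have hg := norm_gradient_radial_le (norm_pos_iff.1 h0) (hasDerivAt_testProfile hχ c L h0 h1)
  have hg2 := pow_le_pow_left₀ (norm_nonneg _) hg 2
  rw [sq_abs, mul_pow] at hg2
  have hα := Real.rpow_pos_of_pos hd α
  calc _ ≤ hypRadius ‖x‖ ^ α * ((hypRadius ‖x‖ ^ (-c)) ^ 2 *
        (-(c * (confFactor ‖x‖ / hypRadius ‖x‖) * χ (Real.log ‖x‖ / L)) +
          deriv χ (Real.log ‖x‖ / L) / (L * ‖x‖)) ^ 2) * confFactor ‖x‖ ^ m := by gcongr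
    _ = _ := by
      rw [← mul_assoc, e, div_pow]
      ring

/-- The Hardy quotient of the test function at scale `L` exceeds `c ^ 2` by `O(1 / L)`. -/
theorem hardy_quotient_testProfile_le {c α L : ℝ} (hcα : 2 * c = m + α)
    (hχ : ContDiff ℝ (⊤ : ℕ∞) χ) (hone : ∀ t, -3 ≤ t → t ≤ -2 → χ t = 1)
    (hsupp : ∀ t, χ t ≠ 0 → -4 ≤ t ∧ t ≤ -1) (hM : ∀ t, |deriv χ t| ≤ M) (hL : 1 ≤ L)
    {φ : EuclideanSpace ℝ (Fin (m + 2)) → ℝ} (hφ : φ = fun x => testProfile χ c L ‖x‖) :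
    (∫ x in ball (0 : EuclideanSpace ℝ (Fin (m + 2))) 1,
        dH x ^ α * ‖gradient φ x‖ ^ 2 * pc x ^ m) ≤
      (c ^ 2 + (c ^ 2 + 3 * 2 ^ (2 * m + 3) * M ^ 2) / L) *
        ∫ x in ball (0 : EuclideanSpace ℝ (Fin (m + 2))) 1,
          dH x ^ (α - 2) * φ x ^ 2 * pc x ^ (m + 2) ∧ φ ≠ 0 := by
  have hL0 : 0 < L := by linarith
  obtain ⟨hsm, hcs, hsub⟩ := testProfile_admissible m hχ hsupp c hL
  have hK := tsupport_testProfile_subset m hsupp c hL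
  rw [← hφ] at hsm hcs hsub hK
  have hχd : Differentiable ℝ χ := hχ.differentiable (by simp)
  have hhalf := exp_neg_le_half hL
  have hA := continuous_potential (α - 2) (m + 2) hsm.continuous hcs hsub
  have hAI := hA.1.integrable_of_hasCompactSupport (μ := volume) hA.2
  have hz (x) (hx : x ∉ tsupport φ) : φ x = 0 := image_eq_zero_of_notMem_tsupport hx
  have hgz (x) (hx : x ∉ tsupport φ) : ‖gradient φ x‖ = 0 := by
    rw [norm_gradient_eq_norm_fderiv, fderiv_of_notMem_tsupport ℝ hx, norm_zero]
  have hpot (x : EuclideanSpace ℝ (Fin (m + 2))) (h0 : 0 < ‖x‖) (h1 : ‖x‖ < 1) :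
      dH x ^ (α - 2) * φ x ^ 2 * pc x ^ (m + 2) =
        (confFactor ‖x‖ / hypRadius ‖x‖) ^ (m + 2) * χ (Real.log ‖x‖ / L) ^ 2 := by
    rw [hφ]; exact potential_testProfile_eq hcα h0 h1
  have hIa : Real.exp (-3 * L) ≤ Real.exp (-2 * L) := Real.exp_le_exp.2 (by linarith)
  have hOa : Real.exp (-4 * L) ≤ Real.exp (-L) := Real.exp_le_exp.2 (by linarith)
  obtain ⟨hinI, hin⟩ := integral_annulusWeight m (Real.exp_pos (-3 * L)) hIa
  obtain ⟨houtI, hout⟩ := integral_annulusWeight m (Real.exp_pos (-4 * L)) hOa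
  rw [← Real.exp_sub, Real.log_exp] at hin hout
  set κ := ((m : ℝ) + 2) * volume.real (ball (0 : EuclideanSpace ℝ (Fin (m + 2))) 1)
  rw [setIntegral_eq_integral_of_forall_compl_eq_zero
      (f := fun x => dH x ^ α * ‖gradient φ x‖ ^ 2 * pc x ^ m)
      (fun x hx => by simp [hgz x fun h => hx (hsub h).1]),
    setIntegral_eq_integral_of_forall_compl_eq_zero
      (f := fun x => dH x ^ (α - 2) * φ x ^ 2 * pc x ^ (m + 2))
      (fun x hx => by simp [hz x fun h => hx (hsub h).1])]
  have hlow : (2 ^ (m + 2))⁻¹ * (κ * L) ≤ ∫ x, dH x ^ (α - 2) * φ x ^ 2 * pc x ^ (m + 2) := by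
    have : κ * L = κ * (-2 * L - -3 * L) := by ring
    rw [this, ← hin, ← integral_const_mul]
    refine integral_mono (hinI.const_mul _) hAI fun x => ?_
    by_cases hx : ‖x‖ ∈ Set.Icc (Real.exp (-3 * L)) (Real.exp (-2 * L))
    · have h0 : 0 < ‖x‖ := (Real.exp_pos _).trans_le hx.1
      have h2 : ‖x‖ ≤ 1 / 2 := hx.2.trans ((Real.exp_le_exp.2 (by linarith)).trans hhalf)
      have h1 : ‖x‖ < 1 := by linarith
      have hχ1 : χ (Real.log ‖x‖ / L) = 1 := by
        apply hone
        · rw [le_div_iff₀ hL0, Real.le_log_iff_exp_le h0]; exact hx.1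
        · rw [div_le_iff₀ hL0, Real.log_le_iff_le_exp h0]; exact hx.2
      have hd := hypRadius_pos h0 h1
      have hq : 1 / (2 * ‖x‖) ≤ confFactor ‖x‖ / hypRadius ‖x‖ := by
        rw [div_le_div_iff₀ (by positivity) hd]
        nlinarith [hypRadius_le_four_mul h0.le h2, two_le_confFactor h0.le h1]
      simp only [hpot x h0 h1, hχ1, annulusWeight, hx, Set.indicator_of_mem]
      refine le_trans (le_of_eq ?_) (mul_le_mul_of_nonneg_right
        (pow_le_pow_left₀ (by positivity) hq (m + 2)) (by norm_num))
      rw [div_pow, mul_pow, one_pow, one_pow, mul_one, one_div, mul_inv]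
    · simp only [annulusWeight, hx, not_false_eq_true, Set.indicator_of_notMem, mul_zero]
      by_cases hy : x ∈ tsupport φ
      · obtain ⟨h0, h1⟩ := norm_mem_of_mem_punctured_ball (hsub hy)
        have := hypRadius_pos h0 h1
        have := confFactor_pos h0.le h1
        rw [hpot x h0 h1]
        positivity
      · simp [hz x hy]
  refine ⟨?_, ?_⟩
  swap
  · rintro rfl
    have hvol : 0 < volume.real (ball (0 : EuclideanSpace ℝ (Fin (m + 2))) 1) :=
      ENNReal.toReal_pos (measure_ball_pos volume _ one_pos).ne' measure_ball_lt_top.ne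
    have : 0 < (2 ^ (m + 2))⁻¹ * (κ * L) := by positivity
    simp at hlow
    linarith
  have hup : ∫ x, dH x ^ α * ‖gradient φ x‖ ^ 2 * pc x ^ m ≤
      (1 + 1 / L) * c ^ 2 * (∫ x, dH x ^ (α - 2) * φ x ^ 2 * pc x ^ (m + 2)) +
        2 ^ (m + 1) * M ^ 2 / L * (κ * (3 * L)) := by
    have : κ * (3 * L) = κ * (-L - -4 * L) := by ring
    rw [this, ← hout, ← integral_const_mul, ← integral_const_mul,
      ← integral_add (hAI.const_mul _) (houtI.const_mul _)]
    have hB := continuous_energy α m hsm hcs hsub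
    refine integral_mono (hB.1.integrable_of_hasCompactSupport hB.2)
      ((hAI.const_mul _).add (houtI.const_mul _)) fun x => ?_
    by_cases hx : x ∈ tsupport φ
    · obtain ⟨h0, h1⟩ := norm_mem_of_mem_punctured_ball (hsub hx)
      have h2 : ‖x‖ ≤ 1 / 2 := (hK hx).2.trans hhalf
      have hd := hypRadius_pos h0 h1
      have hp := confFactor_pos h0.le h1
      have hq : confFactor ‖x‖ / hypRadius ‖x‖ ≤ 2 / ‖x‖ := by
        rw [div_le_div_iff₀ hd h0]
        nlinarith [two_mul_le_hypRadius h0.le h1, confFactor_le_four h0.le h2]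
      have hmem : ‖x‖ ∈ Set.Icc (Real.exp (-4 * L)) (Real.exp (-L)) := hK hx
      simp only [hpot x h0 h1, annulusWeight, hmem, Set.indicator_of_mem]
      refine le_trans ?_ (energy_error_le hL h0 (by positivity) hq
        (hM (Real.log ‖x‖ / L)))
      rw [hφ]
      exact energy_testProfile_le hcα hχd h0 h1
    · have : 0 ≤ 2 ^ (m + 1) * M ^ 2 / L *
          annulusWeight (m + 2) (Real.exp (-4 * L)) (Real.exp (-L)) ‖x‖ :=
        mul_nonneg (by positivity) (annulusWeight_nonneg _ (Real.exp_pos _) _)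
      simpa [hz x hx, hgz x hx] using this
  have hfin : 2 ^ (m + 1) * M ^ 2 / L * (κ * (3 * L)) ≤ 3 * 2 ^ (2 * m + 3) * M ^ 2 / L *
      ∫ x, dH x ^ (α - 2) * φ x ^ 2 * pc x ^ (m + 2) := by
    refine le_trans (le_of_eq ?_) (mul_le_mul_of_nonneg_left hlow (by positivity))
    field_simp
    ring
  refine (hup.trans (add_le_add_right hfin _)).trans (le_of_eq ?_)
  ring

end UpperBound

theorem hardy_constant_is_sharp (n : ℕ) (hn : 2 ≤ n) (α : ℝ)
    (hα : 0 < (n : ℝ) + α - 2) :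
    IsGLB
      {t : ℝ | ∃ φ : EuclideanSpace ℝ (Fin n) → ℝ, ContDiff ℝ (⊤ : ℕ∞) φ ∧
        HasCompactSupport φ ∧
        tsupport φ ⊆ ball (0 : EuclideanSpace ℝ (Fin n)) 1 \ {0} ∧ φ ≠ 0 ∧
        t = (∫ x in ball (0 : EuclideanSpace ℝ (Fin n)) 1,
              dH x ^ α * ‖gradient φ x‖ ^ 2 * pc x ^ (n - 2)) /
            (∫ x in ball (0 : EuclideanSpace ℝ (Fin n)) 1,
              dH x ^ (α - 2) * φ x ^ 2 * pc x ^ n)}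
      ((((n : ℝ) + α - 2) / 2) ^ 2) := by
  obtain ⟨m, rfl⟩ := Nat.exists_eq_add_of_le' hn
  set c := (((m + 2 : ℕ) : ℝ) + α - 2) / 2 with hc
  have hc0 : 0 < c := by positivity
  have hcα : 2 * c = m + α := by rw [hc]; push_cast; ring
  constructor
  · rintro t ⟨φ, hφ, hcs, hsub, hne, rfl⟩
    rw [le_div_iff₀ (potential_integral_pos _ _ hφ.continuous hcs hsub hne)]
    exact hardy_inequality α hc0 hcα hφ hcs hsub
  · intro b hb
    obtain ⟨χ, M, hχ, hone, hsupp, hM⟩ := exists_plateau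
    have hbL (L : ℝ) (hL : 1 ≤ L) :
        b ≤ c ^ 2 + (c ^ 2 + 3 * 2 ^ (2 * m + 3) * M ^ 2) / L := by
      obtain ⟨hsm, hcs, hsub⟩ := testProfile_admissible m hχ hsupp c hL
      obtain ⟨hle, hne⟩ := hardy_quotient_testProfile_le hcα hχ hone hsupp hM hL rfl
      refine (hb ⟨_, hsm, hcs, hsub, hne, rfl⟩).trans ?_
      rw [div_le_iff₀ (potential_integral_pos _ _ hsm.continuous hcs hsub hne)]
      exact hle
    have hlim : Filter.Tendsto (fun L : ℝ => c ^ 2 + (c ^ 2 + 3 * 2 ^ (2 * m + 3) * M ^ 2) / L)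
        Filter.atTop (nhds (c ^ 2 + 0)) :=
      tendsto_const_nhds.add (tendsto_const_nhds.div_atTop Filter.tendsto_id)
    rw [add_zero] at hlim
    exact ge_of_tendsto hlim ((Filter.eventually_ge_atTop 1).mono hbL)
end

section
/- Let n ≥ 2, let Bⁿ = {x ∈ ℝⁿ : |x| < 1}, p(x) = 2/(1−|x|²), and d(x) = log((1+|x|)/(1−|x|)), and let c > 0 be the constant from the improved hyperbolic Hardy inequality with α = 0. Then for every compactly supported smooth function φ on Bⁿ \ {0}: ( ∫_{Bⁿ} d² φ² p^n dx ) · ( ∫_{Bⁿ} |∇φ|² p^{n−2} dx − c·2^{n−2} ∫_{Bⁿ} φ² dx ) ≥ ((n−2)/2)² · ( ∫_{Bⁿ} φ² p^n dx )². -/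
open MeasureTheory Metric

section Helpers

/-- The square of a test function supported in an open set `U`, multiplied by a weight continuous
on `U`, is integrable. -/
theorem integrable_weight_mul_sq {E : Type*} [TopologicalSpace E] [MeasurableSpace E]
    [OpensMeasurableSpace E] {μ : Measure E} [IsFiniteMeasureOnCompacts μ]
    {w φ : E → ℝ} {U : Set E} (hU : IsOpen U) (hw : ContinuousOn w U) (hφ : Continuous φ)
    (hc : HasCompactSupport φ) (hsub : tsupport φ ⊆ U) :
    Integrable (fun x => w x * φ x ^ 2) μ := by
  have hzero : ∀ x, φ x = 0 → w x * φ x ^ 2 = 0 := fun x hx => by simp [hx]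
  have hsupp : Function.support (fun x => w x * φ x ^ 2) ⊆ Function.support φ :=
    fun x hx h => hx (hzero x h)
  refine Continuous.integrable_of_hasCompactSupport ?_ (hc.mono hsupp)
  refine continuous_of_tsupport fun x hx => ?_
  have hxU : x ∈ U := hsub (closure_mono hsupp hx)
  exact (hw.continuousAt (hU.mem_nhds hxU)).mul (hφ.pow 2).continuousAt

variable {n : ℕ} {x : EuclideanSpace ℝ (Fin n)}

theorem pc_pos (hx : ‖x‖ < 1) : 0 < pc x :=
  div_pos two_pos (by nlinarith [norm_nonneg x])

theorem dH_pos (hx : ‖x‖ < 1) (hx0 : x ≠ 0) : 0 < dH x := by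
  have h := norm_pos_iff.2 hx0
  exact Real.log_pos ((one_lt_div (by linarith)).2 (by linarith))

theorem continuousOn_pc :
    ContinuousOn (pc (n := n)) (ball (0 : EuclideanSpace ℝ (Fin n)) 1) := by
  refine continuousOn_const.div (by fun_prop) fun x hx => ?_
  rw [mem_ball_zero_iff] at hx
  nlinarith [norm_nonneg x]

theorem continuousOn_dH :
    ContinuousOn (dH (n := n)) (ball (0 : EuclideanSpace ℝ (Fin n)) 1) := by
  have hlt : ∀ x ∈ ball (0 : EuclideanSpace ℝ (Fin n)) 1, 0 < 1 - ‖x‖ := fun x hx =>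
    sub_pos.2 (mem_ball_zero_iff.1 hx)
  refine ContinuousOn.log (ContinuousOn.div (by fun_prop) (by fun_prop)
    fun x hx => (hlt x hx).ne') fun x hx => ?_
  exact (div_pos (by positivity) (hlt x hx)).ne'

/-- The Cauchy–Schwarz inequality pairing the weights `dH ^ 2` and `dH ^ (-2)` with respect to the
hyperbolic volume. -/
theorem sq_integral_le_integral_dH_mul_integral_dH_inv {φ : EuclideanSpace ℝ (Fin n) → ℝ}
    (hφ : Continuous φ) (hφsupp : HasCompactSupport φ)
    (hφsub : tsupport φ ⊆ ball (0 : EuclideanSpace ℝ (Fin n)) 1 \ {0}) :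
    (∫ x in ball (0 : EuclideanSpace ℝ (Fin n)) 1, φ x ^ 2 * pc x ^ n) ^ 2 ≤
      (∫ x in ball (0 : EuclideanSpace ℝ (Fin n)) 1, dH x ^ 2 * φ x ^ 2 * pc x ^ n) *
        ∫ x in ball (0 : EuclideanSpace ℝ (Fin n)) 1,
          dH x ^ (-2 : ℝ) * φ x ^ 2 * pc x ^ n := by
  have hU : IsOpen (ball (0 : EuclideanSpace ℝ (Fin n)) 1 \ {0}) :=
    isOpen_ball.sdiff isClosed_singleton
  have hp : ContinuousOn (fun x : EuclideanSpace ℝ (Fin n) => pc x ^ n) (ball 0 1 \ {0}) :=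
    (continuousOn_pc.mono Set.sdiff_subset).pow n
  have hd : ContinuousOn (dH (n := n)) (ball 0 1 \ {0}) :=
    continuousOn_dH.mono Set.sdiff_subset
  have hdinv : ContinuousOn (fun x : EuclideanSpace ℝ (Fin n) => dH x ^ (-2 : ℝ))
      (ball 0 1 \ {0}) :=
    hd.rpow_const fun x hx => Or.inl (dH_pos (mem_ball_zero_iff.1 hx.1) hx.2).ne'
  have key : ∀ w : EuclideanSpace ℝ (Fin n) → ℝ, ContinuousOn w (ball 0 1 \ {0}) →
      Integrable (fun x => w x * φ x ^ 2 * pc x ^ n) (volume.restrict (ball 0 1)) := by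
    intro w hw
    refine (integrable_weight_mul_sq hU (hw.mul hp) hφ hφsupp hφsub).congr (.of_forall fun x => ?_)
    simp only [Pi.mul_apply]
    ring
  have hA := key (fun x => dH x ^ 2) (hd.pow 2)
  have hB : Integrable (fun x => φ x ^ 2 * pc x ^ n) (volume.restrict (ball 0 1)) := by
    simpa using key _ (continuousOn_const (c := (1 : ℝ)))
  have hC := key _ hdinv
  have hquad : ∀ t : ℝ,
      0 ≤ (∫ x in ball (0 : EuclideanSpace ℝ (Fin n)) 1, dH x ^ 2 * φ x ^ 2 * pc x ^ n) * (t * t) +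
        (-2 * ∫ x in ball (0 : EuclideanSpace ℝ (Fin n)) 1, φ x ^ 2 * pc x ^ n) * t +
        ∫ x in ball (0 : EuclideanSpace ℝ (Fin n)) 1,
          dH x ^ (-2 : ℝ) * φ x ^ 2 * pc x ^ n := by
    intro t
    rw [← integral_const_mul, ← integral_mul_const, ← integral_mul_const,
      ← integral_add (hA.mul_const _) ((hB.const_mul _).mul_const _),
      ← integral_add ((hA.mul_const _).fun_add ((hB.const_mul _).mul_const _)) hC]
    refine setIntegral_nonneg measurableSet_ball fun x hx => ?_
    by_cases hx0 : φ x = 0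
    · simp [hx0]
    have hxU := hφsub (subset_tsupport φ hx0)
    have hx1 := mem_ball_zero_iff.1 hx
    have hdx := dH_pos hx1 hxU.2
    have hpx := pc_pos hx1
    have hinv : dH x ^ (-2 : ℝ) = (dH x)⁻¹ ^ 2 := by
      rw [Real.rpow_neg hdx.le, inv_pow]
      norm_cast
    have hsq : 0 ≤ (t * dH x - (dH x)⁻¹) ^ 2 * φ x ^ 2 * pc x ^ n := by positivity
    rw [hinv]
    have hcancel : dH x * (dH x)⁻¹ = 1 := mul_inv_cancel₀ hdx.ne'
    linear_combination hsq - 2 * t * φ x ^ 2 * pc x ^ n * hcancel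
  have hdiscrim := discrim_le_zero hquad
  rw [discrim] at hdiscrim
  linarith

end Helpers

theorem improved_uncertainty_hyperbolic (n : ℕ) (hn : 2 ≤ n) (c : ℝ) (hc : 0 < c)
    (hHardy : ∀ φ : EuclideanSpace ℝ (Fin n) → ℝ, ContDiff ℝ (⊤ : ℕ∞) φ →
      HasCompactSupport φ →
      tsupport φ ⊆ ball (0 : EuclideanSpace ℝ (Fin n)) 1 \ {0} →
      (∫ x in ball (0 : EuclideanSpace ℝ (Fin n)) 1,
          ‖gradient φ x‖ ^ 2 * pc x ^ (n - 2)) ≥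
        (((n : ℝ) - 2) / 2) ^ 2 *
            (∫ x in ball (0 : EuclideanSpace ℝ (Fin n)) 1,
              dH x ^ (-2 : ℝ) * φ x ^ 2 * pc x ^ n) +
          c * 2 ^ (n - 2) * (∫ x in ball (0 : EuclideanSpace ℝ (Fin n)) 1, φ x ^ 2))
    (φ : EuclideanSpace ℝ (Fin n) → ℝ) (hφ : ContDiff ℝ (⊤ : ℕ∞) φ)
    (hφsupp : HasCompactSupport φ)
    (hφsub : tsupport φ ⊆ ball (0 : EuclideanSpace ℝ (Fin n)) 1 \ {0}) :
    (∫ x in ball (0 : EuclideanSpace ℝ (Fin n)) 1, dH x ^ 2 * φ x ^ 2 * pc x ^ n) *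
        ((∫ x in ball (0 : EuclideanSpace ℝ (Fin n)) 1, ‖gradient φ x‖ ^ 2 * pc x ^ (n - 2)) -
          c * 2 ^ (n - 2) * (∫ x in ball (0 : EuclideanSpace ℝ (Fin n)) 1, φ x ^ 2)) ≥
      (((n : ℝ) - 2) / 2) ^ 2 *
        (∫ x in ball (0 : EuclideanSpace ℝ (Fin n)) 1, φ x ^ 2 * pc x ^ n) ^ 2 := by
  have hcs := sq_integral_le_integral_dH_mul_integral_dH_inv hφ.continuous hφsupp hφsub
  have hA : 0 ≤ ∫ x in ball (0 : EuclideanSpace ℝ (Fin n)) 1, dH x ^ 2 * φ x ^ 2 * pc x ^ n :=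
    setIntegral_nonneg measurableSet_ball fun x hx => by
      have := pc_pos (mem_ball_zero_iff.1 hx)
      positivity
  refine (mul_le_mul_of_nonneg_left hcs (sq_nonneg (((n : ℝ) - 2) / 2))).trans ?_
  rw [mul_left_comm]
  exact mul_le_mul_of_nonneg_left (le_sub_iff_add_le.2 (hHardy φ hφ hφsupp hφsub)) hA
end
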